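/- arXiv:2402.16662 — 2 statements merged into one kernel-verified Lean document; each statement's English description precedes it below -/
import Mathlib

section
/- Let Δ : ℝ → ℝ satisfy: Δ(0) = 0, Δ(t) ≥ 0 for all t ≥ 0, Δ is bounded above on [0, ∞), and Δ is continuous at 0 within [0, ∞). Define Δ'(t) = inf { a·t + b : a ≥ 0, b ≥ 0, and Δ(s) ≤ a·s + b for all s ≥ 0 }. Then on [0, ∞): Δ'(0) = 0; Δ' is non-decreasing; Δ' is subadditive, i.e. Δ'(x + y) ≤ Δ'(x) + Δ'(y) for all x, y ≥ 0; Δ' is continuous at every point of [0, ∞) within [0, ∞); and Δ(t) ≤ Δ'(t) for all t ≥ 0. Consequently, if f : M → N is a map between pseudometric spaces obeying Δ, i.e. dist(f(x), f(y)) ≤ Δ(dist(x, y)) for all x, y ∈ M, then f also obeys Δ'. -/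
/-- Smoothing a modulus.  If `Δ : ℝ → ℝ` vanishes at `0`, is nonnegative
and bounded above on `[0,∞)` and continuous at `0` within `[0,∞)`, and
`Δ' t = inf { a*t + b : a, b ≥ 0, Δ s ≤ a*s + b for all s ≥ 0 }`, then `Δ'` vanishes at
`0`, is non-decreasing, subadditive and continuous on `[0,∞)`, dominates `Δ` on `[0,∞)`,
and every map between pseudometric spaces obeying `Δ` also obeys `Δ'`. -/
theorem stmt1 {M N : Type*} [PseudoMetricSpace M] [PseudoMetricSpace N]
    (Δ Δ' : ℝ → ℝ)
    (h0 : Δ 0 = 0)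
    (hnn : ∀ t : ℝ, 0 ≤ t → 0 ≤ Δ t)
    (hbd : ∃ C : ℝ, ∀ t : ℝ, 0 ≤ t → Δ t ≤ C)
    (hcont : ContinuousWithinAt Δ (Set.Ici 0) 0)
    (hΔ' : ∀ t : ℝ, Δ' t =
      sInf {y : ℝ | ∃ a b : ℝ, 0 ≤ a ∧ 0 ≤ b ∧
        (∀ s : ℝ, 0 ≤ s → Δ s ≤ a * s + b) ∧ y = a * t + b}) :
    Δ' 0 = 0 ∧
    (∀ x y : ℝ, 0 ≤ x → x ≤ y → Δ' x ≤ Δ' y) ∧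
    (∀ x y : ℝ, 0 ≤ x → 0 ≤ y → Δ' (x + y) ≤ Δ' x + Δ' y) ∧
    (∀ t ∈ Set.Ici (0 : ℝ), ContinuousWithinAt Δ' (Set.Ici 0) t) ∧
    (∀ t : ℝ, 0 ≤ t → Δ t ≤ Δ' t) ∧
    (∀ f : M → N, (∀ x y : M, dist (f x) (f y) ≤ Δ (dist x y)) →
      ∀ x y : M, dist (f x) (f y) ≤ Δ' (dist x y)) := by
  obtain ⟨C, hC⟩ := hbd
  have hC0 : 0 ≤ C := by have := hC 0 le_rfl; rwa [h0] at this
  have hle : ∀ t a b : ℝ, 0 ≤ t → 0 ≤ a → 0 ≤ b → (∀ s : ℝ, 0 ≤ s → Δ s ≤ a * s + b) →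
      Δ' t ≤ a * t + b := by
    intro t a b ht ha hb h
    rw [hΔ']
    refine csInf_le ⟨0, ?_⟩ ⟨a, b, ha, hb, h, rfl⟩
    rintro y ⟨a, b, ha, hb, -, rfl⟩
    positivity
  have hge : ∀ t c : ℝ, (∀ a b : ℝ, 0 ≤ a → 0 ≤ b → (∀ s : ℝ, 0 ≤ s → Δ s ≤ a * s + b) →
      c ≤ a * t + b) → c ≤ Δ' t := by
    intro t c h
    rw [hΔ']
    refine le_csInf ⟨_, 0, C, le_rfl, hC0, fun s hs => by simpa using hC s hs, rfl⟩ ?_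
    rintro y ⟨a, b, ha, hb, h', rfl⟩
    exact h a b ha hb h'
  have hsmall : ∀ ε : ℝ, 0 < ε → ∃ a : ℝ, 0 ≤ a ∧ ∀ s : ℝ, 0 ≤ s → Δ s ≤ a * s + ε := by
    intro ε hε
    obtain ⟨δ, hδ, h⟩ := Metric.continuousWithinAt_iff.1 hcont ε hε
    refine ⟨C / δ, by positivity, fun s hs => ?_⟩
    rcases lt_or_ge s δ with hs' | hs'
    · have h1 := h (x := s) hs (by rw [Real.dist_eq, sub_zero, abs_of_nonneg hs]; exact hs')
      rw [Real.dist_eq, h0, sub_zero] at h1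
      have h2 := le_abs_self (Δ s)
      have : 0 ≤ C / δ * s := by positivity
      linarith
    · have h1 : C / δ * δ ≤ C / δ * s := by gcongr
      rw [div_mul_cancel₀ _ hδ.ne'] at h1
      have := hC s hs
      linarith
  have hdom : ∀ t : ℝ, 0 ≤ t → Δ t ≤ Δ' t := fun t ht => hge t _ fun a b _ _ h => h t ht
  have hmono : ∀ x y : ℝ, 0 ≤ x → x ≤ y → Δ' x ≤ Δ' y := by
    intro x y hx hxy
    refine hge y _ fun a b ha hb h => (hle x a b hx ha hb h).trans ?_
    gcongr
  have hsub : ∀ x y : ℝ, 0 ≤ x → 0 ≤ y → Δ' (x + y) ≤ Δ' x + Δ' y := by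
    intro x y hx hy
    rw [← sub_le_iff_le_add]
    refine hge x _ fun a b ha hb h => ?_
    rw [sub_le_comm]
    refine hge y _ fun a' b' ha' hb' h' => ?_
    rcases le_total a a' with haa | haa
    · have h1 := hle (x + y) a b (by positivity) ha hb h
      have h2 := mul_le_mul_of_nonneg_right haa hy
      linarith
    · have h1 := hle (x + y) a' b' (by positivity) ha' hb' h'
      have h2 := mul_le_mul_of_nonneg_right haa hx
      linarith
  refine ⟨?_, hmono, hsub, ?_, hdom, fun f hf x y => (hf x y).trans (hdom _ dist_nonneg)⟩
  · refine le_antisymm (le_of_forall_pos_le_add fun ε hε => ?_) (by simpa [h0] using hdom 0 le_rfl)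
    obtain ⟨a, ha, h⟩ := hsmall ε hε
    have := hle 0 a ε le_rfl ha hε.le h
    linarith
  · intro t ht
    rw [Metric.continuousWithinAt_iff]
    intro ε hε
    obtain ⟨a, ha, h⟩ := hsmall (ε / 2) (by positivity)
    have key : ∀ x y : ℝ, 0 ≤ x → 0 ≤ y → Δ' x - Δ' y ≤ a * |x - y| + ε / 2 := by
      intro x y hx hy
      have h1 := hmono x (y + |x - y|) hx (by linarith [le_abs_self (x - y)])
      have h2 := hsub y |x - y| hy (abs_nonneg _)
      have h3 := hle |x - y| a (ε / 2) (abs_nonneg _) ha (by positivity) h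
      linarith
    refine ⟨ε / (2 * (a + 1)), by positivity, fun x hx hxt => ?_⟩
    rw [Real.dist_eq] at hxt ⊢
    rw [lt_div_iff₀ (by positivity)] at hxt
    have k1 := key x t hx ht
    have k2 := key t x ht hx
    rw [abs_sub_comm t x] at k2
    have hpos : 0 ≤ |x - t| := abs_nonneg _
    rcases hpos.eq_or_lt with h' | h'
    · have : x = t := by
        have := abs_eq_zero.1 h'.symm
        linarith
      simpa [this] using hε
    · rw [abs_lt]
      constructor <;> nlinarith
end

section
/- Let X be a nonempty set, m a natural number, and Δ a modulus. Let W be a set of functions u : (Fin m → ℝ) → ℝ such that every u ∈ W maps the unit cube K = { x : Fin m → ℝ | x i ∈ [0,1] for all i } into [0,1] and satisfies |u(x) − u(y)| ≤ Δ(dist(x, y)) for all x, y ∈ K, where dist is the supremum metric on Fin m → ℝ. Let S be a set of functions X → ℝ, each with values in [0,1], that is totally bounded with respect to the uniform distance d(f, g) = sup_{x ∈ X} |f(x) − g(x)|. Then the set T = { x ↦ u(f(0)(x), …, f(m−1)(x)) : u ∈ W, f : Fin m → ℝ-valued functions with f(i) ∈ S for all i } is totally bounded with respect to the uniform distance on [0,1]-valued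 functions on X. -/
/-- A family `S` of real-valued functions on `X` is totally bounded in the uniform
distance: for every `ε > 0` there is a finite ε-net. -/
def TotallyBoundedUnif {X : Type*} (S : Set (X → ℝ)) : Prop :=
  ∀ ε : ℝ, 0 < ε → ∃ F : Finset (X → ℝ), ∀ f ∈ S, ∃ g ∈ F, ∀ x, |f x - g x| ≤ ε

theorem tb_of_code {X A C : Type*} [Finite C] (H : A → X → ℝ) (R : A → C → Prop) (ε : ℝ)
    (h1 : ∀ a, ∃ c, R a c) (h2 : ∀ a b c, R a c → R b c → ∀ x, |H a x - H b x| ≤ ε) :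
    ∃ F : Finset (X → ℝ), ∀ a, ∃ g ∈ F, ∀ x, |H a x - g x| ≤ ε := by
  classical
  have := Fintype.ofFinite C
  refine ⟨Finset.univ.image
    (fun c : C => if h : ∃ a, R a c then H h.choose else 0), fun a => ?_⟩
  obtain ⟨c, hc⟩ := h1 a
  have h : ∃ a, R a c := ⟨a, hc⟩
  refine ⟨H h.choose, ?_, h2 _ _ c hc h.choose_spec⟩
  refine Finset.mem_image.2 ⟨c, Finset.mem_univ _, ?_⟩
  rw [dif_pos h]

/-- Closing a totally bounded family of `[0,1]`-valued functions under
`m`-ary connectives from an equicontinuous family `W` (all obeying the modulus `Δ` on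
the unit cube and mapping it into `[0,1]`) yields a totally bounded family. -/
theorem stmt5 {X : Type*} [Nonempty X] (m : ℕ) (Δ : ℝ → ℝ)
    (h0 : Δ 0 = 0)
    (hmono : ∀ x y : ℝ, 0 ≤ x → x ≤ y → Δ x ≤ Δ y)
    (hsub : ∀ x y : ℝ, 0 ≤ x → 0 ≤ y → Δ (x + y) ≤ Δ x + Δ y)
    (hcont : Continuous Δ)
    (W : Set ((Fin m → ℝ) → ℝ))
    (hW : ∀ u ∈ W,
      (∀ x : Fin m → ℝ, (∀ i, x i ∈ Set.Icc (0 : ℝ) 1) → u x ∈ Set.Icc (0 : ℝ) 1) ∧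
      (∀ x y : Fin m → ℝ, (∀ i, x i ∈ Set.Icc (0 : ℝ) 1) →
        (∀ i, y i ∈ Set.Icc (0 : ℝ) 1) → |u x - u y| ≤ Δ (dist x y)))
    (S : Set (X → ℝ))
    (hS1 : ∀ f ∈ S, ∀ x, f x ∈ Set.Icc (0 : ℝ) 1)
    (hS2 : TotallyBoundedUnif S) :
    TotallyBoundedUnif
      {h : X → ℝ | ∃ u ∈ W, ∃ f : Fin m → (X → ℝ),
        (∀ i, f i ∈ S) ∧ h = fun x => u (fun i => f i x)} := by
  intro ε hε
  obtain ⟨δ, hδ, hδ'⟩ := Metric.continuousAt_iff.1 (hcont.continuousAt (x := 0)) (ε / 4)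
    (by linarith)
  have hΔ : ∀ t, 0 ≤ t → t < δ → Δ t ≤ ε / 4 := by
    intro t ht htd
    have h := hδ' (x := t) (by rw [Real.dist_eq, sub_zero, abs_of_nonneg ht]; exact htd)
    rw [h0, Real.dist_eq, sub_zero] at h
    exact (le_abs_self _).trans h.le
  obtain ⟨F, hF⟩ := hS2 (δ / 4) (by linarith)
  obtain ⟨P, hPK, hPf, hP⟩ := Metric.finite_approx_of_totallyBounded
    (isCompact_univ_pi (fun _ : Fin m => isCompact_Icc (a := (0 : ℝ)) (b := 1))).totallyBounded
    δ hδ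
  obtain ⟨Q, hQI, hQf, hQ⟩ := Metric.finite_approx_of_totallyBounded
    (isCompact_Icc (a := (0 : ℝ)) (b := 1)).totallyBounded (ε / 8) (by linarith)
  have := hPf.to_subtype
  have := hQf.to_subtype
  have key := tb_of_code (A := {a : ((Fin m → ℝ) → ℝ) × (Fin m → (X → ℝ)) //
      a.1 ∈ W ∧ ∀ i, a.2 i ∈ S}) (C := (Fin m → F) × (P → Q))
    (fun a x => a.1.1 (fun i => a.1.2 i x))
    (fun a c => (∀ i x, |a.1.2 i x - (c.1 i : X → ℝ) x| ≤ δ / 4) ∧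
      ∀ p : P, |a.1.1 p - (c.2 p : ℝ)| < ε / 8) ε
  refine Exists.elim (key ?_ ?_) ?_
  · rintro ⟨⟨u, f⟩, hu, hf⟩
    choose g hg hg' using fun i => hF (f i) (hf i)
    have hq : ∀ p : P, ∃ q : Q, |u p - (q : ℝ)| < ε / 8 := by
      intro p
      have h := hQ ((hW u hu).1 p (fun i => hPK p.2 i (Set.mem_univ _)))
      simp only [Set.mem_iUnion, Metric.mem_ball, Real.dist_eq] at h
      obtain ⟨q, hq, h⟩ := h
      exact ⟨⟨q, hq⟩, h⟩
    choose q hq using hq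
    exact ⟨(fun i => ⟨g i, hg i⟩, q), hg', hq⟩
  · rintro ⟨⟨u, f⟩, hu, hf⟩ ⟨⟨v, g⟩, hv, hg⟩ ⟨c, q⟩ ⟨ha, ha'⟩ ⟨hb, hb'⟩ x
    dsimp only at *
    have hfx : ∀ i, f i x ∈ Set.Icc (0 : ℝ) 1 := fun i => hS1 _ (hf i) x
    have hgx : ∀ i, g i x ∈ Set.Icc (0 : ℝ) 1 := fun i => hS1 _ (hg i) x
    have h := hP (show (fun i => f i x) ∈ _ from fun i _ => hfx i)
    simp only [Set.mem_iUnion, Metric.mem_ball] at h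
    obtain ⟨p, hp, hd⟩ := h
    have hpK : ∀ i, p i ∈ Set.Icc (0 : ℝ) 1 := fun i => hPK hp i (Set.mem_univ _)
    have e1 := ((hW u hu).2 _ p hfx hpK).trans (hΔ _ dist_nonneg hd)
    have e2 := ((hW v hv).2 _ p hfx hpK).trans (hΔ _ dist_nonneg hd)
    have hd2 : dist (fun i => f i x) (fun i => g i x) ≤ δ / 2 := by
      rw [dist_pi_le_iff (by linarith)]
      intro i
      rw [Real.dist_eq]
      have h1 := abs_le.1 (ha i x)
      have h2 := abs_le.1 (hb i x)
      rw [abs_le]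
      constructor <;> linarith [h1.1, h1.2, h2.1, h2.2]
    have e3 := ((hW v hv).2 _ _ hfx hgx).trans (hΔ _ dist_nonneg (by linarith))
    have e4 := abs_lt.1 (ha' ⟨p, hp⟩)
    have e5 := abs_lt.1 (hb' ⟨p, hp⟩)
    rw [abs_le] at e1 e2 e3 ⊢
    dsimp only at *
    constructor <;> linarith [e1.1, e1.2, e2.1, e2.2, e3.1, e3.2, e4.1, e4.2, e5.1, e5.2]
  · intro G hG
    refine ⟨G, ?_⟩
    rintro h ⟨u, hu, f, hf, rfl⟩
    exact hG ⟨(u, f), hu, hf⟩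
end
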